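/- Let q, x be complex numbers with |q| < 1 such that x·q^{2k} ≠ 1 for every integer k ≥ 1. Then Σ_{n=0}^{∞} q^{n²} (−x)^n / (q;q)_n = ( ∏_{k=1}^{∞} (1 − x q^{2k}) ) · Σ_{n=0}^{∞} q^{n²} (−x)^n / ( (q²;q²)_n · ∏_{k=1}^{n} (1 − x q^{2k}) ), where all series converge absolutely under these hypotheses. -/

import Mathlib

open scoped BigOperators

/-- The finite q-Pochhammer symbol `(a;q)_n = ∏_{i=0}^{n-1} (1 - a q^i)`. -/
noncomputable def qPoch (a q : ℂ) (n : ℕ) : ℂ := ∏ i ∈ Finset.range n, (1 - a * q ^ i)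

open Filter Topology

lemma qPoch_zero (a q : ℂ) : qPoch a q 0 = 1 := by simp [qPoch]

lemma qPoch_succ (a q : ℂ) (n : ℕ) : qPoch a q (n + 1) = qPoch a q n * (1 - a * q ^ n) :=
  Finset.prod_range_succ _ _

lemma one_sub_mul_pow_ne_zero {q : ℂ} (hq : ‖q‖ < 1) (n : ℕ) : 1 - q * q ^ n ≠ 0 := by
  intro h
  have h1 : ‖q ^ (n + 1)‖ = 1 := by rw [pow_succ', ← sub_eq_zero.mp h, norm_one]
  rw [norm_pow] at h1
  exact absurd h1 (pow_lt_one₀ (norm_nonneg _) hq (Nat.succ_ne_zero n)).ne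

lemma qPoch_self_ne_zero {q : ℂ} (hq : ‖q‖ < 1) (n : ℕ) : qPoch q q n ≠ 0 :=
  Finset.prod_ne_zero_iff.mpr fun i _ => one_sub_mul_pow_ne_zero hq i

lemma norm_sq_lt_one {q : ℂ} (hq : ‖q‖ < 1) : ‖q ^ 2‖ < 1 := by
  rw [norm_pow]
  exact pow_lt_one₀ (norm_nonneg _) hq two_ne_zero

lemma summable_norm_of_ratio_tendsto_zero {f r : ℕ → ℂ} (hf : ∀ n, f (n + 1) = r n * f n)
    (hr : Tendsto r atTop (𝓝 0)) : Summable fun n => ‖f n‖ := by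
  refine summable_of_ratio_norm_eventually_le (r := 1 / 2) (by norm_num) ?_
  have h := hr.norm.eventually_le_const (u := (1 / 2 : ℝ)) (by norm_num)
  filter_upwards [h] with n hn
  rw [hf, norm_norm, norm_norm, norm_mul]
  gcongr

lemma tendsto_one_sub_mul_pow {q : ℂ} (hq : ‖q‖ < 1) (a : ℂ) :
    Tendsto (fun n : ℕ => 1 - a * q ^ n) atTop (𝓝 1) := by
  simpa using ((tendsto_pow_atTop_nhds_zero_of_norm_lt_one hq).const_mul a).const_sub 1

lemma tendsto_mul_pow_odd {q : ℂ} (hq : ‖q‖ < 1) (y : ℂ) :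
    Tendsto (fun n : ℕ => y * q * (q ^ 2) ^ n) atTop (𝓝 0) := by
  simpa using (tendsto_pow_atTop_nhds_zero_of_norm_lt_one (norm_sq_lt_one hq)).const_mul (y * q)

/-- The theta-type series `∑ q^{n²} yⁿ / (a;p)_n` converges absolutely. -/
lemma summable_theta_div_qPoch {q p : ℂ} (hq : ‖q‖ < 1) (hp : ‖p‖ < 1) (a y : ℂ) :
    Summable fun n : ℕ => ‖q ^ (n ^ 2) * y ^ n / qPoch a p n‖ := by
  refine summable_norm_of_ratio_tendsto_zero
    (r := fun n => y * q * (q ^ 2) ^ n / (1 - a * p ^ n)) (fun n => ?_) ?_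
  · rw [qPoch_succ, div_mul_div_comm, mul_comm (1 - _)]
    congr 1
    ring
  · simpa [Pi.div_def] using
      (tendsto_mul_pow_odd hq y).div (tendsto_one_sub_mul_pow hp a) one_ne_zero

lemma summable_theta_div_qPoch_mul {q p : ℂ} (hq : ‖q‖ < 1) (hp : ‖p‖ < 1) (a b y : ℂ) :
    Summable fun n : ℕ => ‖q ^ (n ^ 2) * y ^ n / (qPoch a p n * qPoch b p n)‖ := by
  refine summable_norm_of_ratio_tendsto_zero
    (r := fun n => y * q * (q ^ 2) ^ n / ((1 - a * p ^ n) * (1 - b * p ^ n))) (fun n => ?_) ?_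
  · rw [qPoch_succ, qPoch_succ, div_mul_div_comm]
    congr 1 <;> ring
  · simpa [Pi.div_def] using (tendsto_mul_pow_odd hq y).div
      ((tendsto_one_sub_mul_pow hp a).mul (tendsto_one_sub_mul_pow hp b)) (by simp)

/-- Euler's series `∑ q^{n²} yⁿ / (q²;q²)_n`, whose sum is `(-yq;q²)_∞`. -/
noncomputable def eulerSeries (q y : ℂ) : ℂ :=
  ∑' n : ℕ, q ^ (n ^ 2) * y ^ n / qPoch (q ^ 2) (q ^ 2) n

lemma eulerSeries_eq_mul {q : ℂ} (hq : ‖q‖ < 1) (y : ℂ) :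
    eulerSeries q y = (1 + y * q) * eulerSeries q (y * q ^ 2) := by
  have hp := norm_sq_lt_one hq
  have h1 := (summable_theta_div_qPoch hq hp (q ^ 2) y).of_norm
  have h2 := (summable_theta_div_qPoch hq hp (q ^ 2) (y * q ^ 2)).of_norm
  have key : eulerSeries q y - eulerSeries q (y * q ^ 2)
      = y * q * eulerSeries q (y * q ^ 2) := by
    unfold eulerSeries
    rw [← h1.tsum_sub h2, (h1.sub h2).tsum_eq_zero_add, ← tsum_mul_left]
    simp only [pow_zero, sub_self, zero_add]
    refine tsum_congr fun n => ?_
    have ha := qPoch_self_ne_zero hp n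
    have hb := one_sub_mul_pow_ne_zero hp n
    rw [qPoch_succ]
    field_simp
    ring
  linear_combination key

lemma eulerSeries_eq_qPoch_mul {q : ℂ} (hq : ‖q‖ < 1) (y : ℂ) (n : ℕ) :
    eulerSeries q y = qPoch (-(y * q)) (q ^ 2) n * eulerSeries q (y * (q ^ 2) ^ n) := by
  induction n with
  | zero => simp [qPoch_zero]
  | succ n ih =>
    rw [ih, eulerSeries_eq_mul hq (y * (q ^ 2) ^ n), qPoch_succ, pow_succ (q ^ 2) n]
    ring_nf

lemma tendsto_eulerSeries {q : ℂ} (hq : ‖q‖ < 1) (y : ℂ) :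
    Tendsto (fun n : ℕ => eulerSeries q (y * (q ^ 2) ^ n)) atTop (𝓝 1) := by
  have hp := norm_sq_lt_one hq
  have h0 : ∑' m : ℕ, (if m = 0 then (1 : ℂ) else 0) = 1 := tsum_ite_eq 0 _
  rw [← h0]
  refine tendsto_tsum_of_dominated_convergence (summable_theta_div_qPoch hq hp (q ^ 2) y)
    (fun m => ?_) (Eventually.of_forall fun n m => ?_)
  · rcases eq_or_ne m 0 with rfl | hm
    · simp [qPoch_zero]
    · have h1 := ((tendsto_pow_atTop_nhds_zero_of_norm_lt_one hp).const_mul y).pow m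
      have h2 := (h1.const_mul (q ^ (m ^ 2))).div_const (qPoch (q ^ 2) (q ^ 2) m)
      simpa [hm] using h2
  · rw [norm_div, norm_div, norm_mul, norm_mul, norm_pow (y * _), norm_pow y, norm_mul y]
    gcongr
    rw [norm_pow]
    exact mul_le_of_le_one_right (norm_nonneg _) (pow_le_one₀ (norm_nonneg _) hp.le)

/-- Euler's product formula. -/
lemma tprod_eq_eulerSeries {q : ℂ} (hq : ‖q‖ < 1) (y : ℂ) :
    ∏' k : ℕ, (1 - -(y * q) * (q ^ 2) ^ k) = eulerSeries q y := by
  have hp := norm_sq_lt_one hq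
  have hm : Multipliable fun k : ℕ => (1 - -(y * q) * (q ^ 2) ^ k) := by
    simp only [sub_eq_add_neg]
    refine multipliable_one_add_of_summable ?_
    simp only [norm_neg, norm_mul, norm_pow _ (_ : ℕ)]
    refine Summable.mul_left _ (summable_geometric_of_lt_one (by positivity) ?_)
    rwa [← norm_pow]
  have h := hm.hasProd.tendsto_prod_nat.mul (tendsto_eulerSeries hq y)
  rw [mul_one] at h
  refine tendsto_nhds_unique h (tendsto_const_nhds.congr fun n => ?_)
  exact eulerSeries_eq_qPoch_mul hq y n

lemma sum_antidiagonal_pow_div_qPoch {q : ℂ} (hq : ‖q‖ < 1) (N : ℕ) :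
    ∑ z ∈ Finset.HasAntidiagonal.antidiagonal N,
      q ^ z.2 / (qPoch (q ^ 2) (q ^ 2) z.1 * qPoch (q ^ 2) (q ^ 2) z.2) = 1 / qPoch q q N := by
  have hp := norm_sq_lt_one hq
  induction N with
  | zero => simp [qPoch_zero]
  | succ N ih =>
    have hN := one_sub_mul_pow_ne_zero hq N
    rw [qPoch_succ, ← div_div, ← ih, eq_div_iff hN, mul_sub, mul_one, ← pow_succ']
    nth_rw 2 [← Finset.Nat.sum_antidiagonal_swap]
    rw [Finset.sum_mul, ← Finset.sum_sub_distrib, Finset.Nat.sum_antidiagonal_succ]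
    simp only [Prod.fst_swap, Prod.snd_swap]
    rw [add_eq_right.mpr (by ring)]
    refine Finset.sum_congr rfl fun z hz => ?_
    rw [← Finset.HasAntidiagonal.mem_antidiagonal.mp hz, qPoch_succ]
    have ha := qPoch_self_ne_zero hp z.1
    have hb := qPoch_self_ne_zero hp z.2
    have hc := one_sub_mul_pow_ne_zero hp z.1
    field_simp
    ring

/-- Ramanujan's identity (Theorem 2): for `|q| < 1` with `xq^{2k} ≠ 1` for all `k ≥ 1`,
`Σ_n q^{n²}(−x)^n/(q;q)_n = (xq²;q²)_∞ Σ_n q^{n²}(−x)^n/((q²;q²)_n (xq²;q²)_n)`,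
with all series converging absolutely. -/
theorem stmt2 (q x : ℂ) (hq : ‖q‖ < 1)
    (hx : ∀ k : ℕ, 1 ≤ k → x * q ^ (2 * k) ≠ 1) :
    Summable (fun n : ℕ => ‖q ^ (n ^ 2) * (-x) ^ n / qPoch q q n‖) ∧
    Summable (fun n : ℕ =>
      ‖q ^ (n ^ 2) * (-x) ^ n / (qPoch (q ^ 2) (q ^ 2) n * qPoch (x * q ^ 2) (q ^ 2) n)‖) ∧
    ∑' n : ℕ, q ^ (n ^ 2) * (-x) ^ n / qPoch q q n
      = (∏' k : ℕ, (1 - x * q ^ (2 * (k + 1)))) *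
        ∑' n : ℕ, q ^ (n ^ 2) * (-x) ^ n /
          (qPoch (q ^ 2) (q ^ 2) n * qPoch (x * q ^ 2) (q ^ 2) n) := by
  have hp := norm_sq_lt_one hq
  refine ⟨summable_theta_div_qPoch hq hq q (-x),
    summable_theta_div_qPoch_mul hq hp (q ^ 2) (x * q ^ 2) (-x), ?_⟩
  have hprod : ∏' k : ℕ, (1 - x * q ^ (2 * (k + 1))) = eulerSeries q (-x * q) := by
    rw [← tprod_eq_eulerSeries hq]
    exact tprod_congr fun k => by ring
  have hne (n : ℕ) : qPoch (x * q ^ 2) (q ^ 2) n ≠ 0 := by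
    refine Finset.prod_ne_zero_iff.mpr fun i _ h => hx (i + 1) (Nat.le_add_left 1 i) ?_
    linear_combination -h
  let f : ℕ × ℕ → ℂ := fun z => q ^ (z.1 ^ 2) * (-x) ^ z.1 / qPoch (q ^ 2) (q ^ 2) z.1 *
    (q ^ (z.2 ^ 2) * (-x * q * (q ^ 2) ^ z.1) ^ z.2 / qPoch (q ^ 2) (q ^ 2) z.2)
  have hf : Summable f := by
    have hs := summable_theta_div_qPoch hq hp (q ^ 2) (-x)
    refine Summable.of_norm_bounded
      (hs.mul_of_nonneg hs (fun _ => norm_nonneg _) fun _ => norm_nonneg _) fun z => ?_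
    simp only [f]
    rw [norm_mul]
    gcongr ‖_‖ * ?_
    rw [norm_div, norm_div, norm_mul, norm_mul, norm_pow (-x * _ * _), norm_pow (-x), mul_assoc,
      norm_mul (-x)]
    gcongr
    rw [← pow_mul, ← pow_succ', norm_pow]
    exact mul_le_of_le_one_right (norm_nonneg _) (pow_le_one₀ (norm_nonneg _) hq.le)
  calc ∑' n : ℕ, q ^ (n ^ 2) * (-x) ^ n / qPoch q q n
      = ∑' N : ℕ, ∑ z ∈ Finset.HasAntidiagonal.antidiagonal N, f z := by
        refine tsum_congr fun N => ?_
        rw [div_eq_mul_one_div, ← sum_antidiagonal_pow_div_qPoch hq, Finset.mul_sum]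
        refine Finset.sum_congr rfl fun z hz => ?_
        simp only [f]
        rw [← Finset.HasAntidiagonal.mem_antidiagonal.mp hz, div_mul_div_comm, ← mul_div_assoc]
        congr 1
        ring
    _ = ∑' z : ℕ × ℕ, f z := by
        rw [← Finset.HasAntidiagonal.sigmaAntidiagonalEquivProd.tsum_eq f]
        refine Eq.trans (tsum_congr fun N => ?_) (Summable.tsum_sigma
          (Finset.HasAntidiagonal.sigmaAntidiagonalEquivProd.summable_iff.mpr hf)).symm
        exact (Finset.tsum_subtype _ f).symm
    _ = ∑' n : ℕ, ∑' m : ℕ, f (n, m) := hf.tsum_prod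
    _ = _ := by
        rw [hprod, ← tsum_mul_left]
        refine tsum_congr fun n => ?_
        simp only [f]
        rw [tsum_mul_left, ← eulerSeries, eulerSeries_eq_qPoch_mul hq (-x * q) n,
          show -(-x * q * q) = x * q ^ 2 by ring]
        have ha := qPoch_self_ne_zero hp n
        have hb := hne n
        field_simp
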